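/- There is a universal constant C > 0 with the following property. Let f be a probability density function on an interval I ⊆ ℝ, let k be a positive integer, let ε, δ ∈ (0,1), and let n ≥ C · (k + log(1/δ))/ε². If X_1, …, X_n are drawn i.i.d. from the distribution with density f and μ_n := (1/n) Σ_{i=1}^n δ_{X_i} is the empirical distribution, then with probability at least 1 − δ, ‖μ_n − f‖_{A_k} ≤ ε. -/

import Mathlib

open MeasureTheory Set

/-- The `A_k`-distance between a function `g` and a Borel measure `μ` on a subinterval `J`:
the supremum over all collections of `k` pairwise disjoint subintervals `I₁, …, I_k` of `J`
of `∑ᵢ |μ(Iᵢ) − ∫_{Iᵢ} g|`. -/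
noncomputable def akDist (k : ℕ) (J : Set ℝ) (g : ℝ → ℝ) (μ : Measure ℝ) : ℝ :=
  sSup { s : ℝ | ∃ I : Fin k → Set ℝ,
    (∀ i, I i ⊆ J ∧ (I i).OrdConnected) ∧
    (Pairwise fun i j => Disjoint (I i) (I j)) ∧
    s = ∑ i, |(μ (I i)).toReal - ∫ x in I i, g x| }

/-- `f` is a probability density function on `I`. -/
def IsPDFOn (f : ℝ → ℝ) (I : Set ℝ) : Prop :=
  (∀ x ∈ I, 0 ≤ f x) ∧ IntegrableOn f I ∧ (∫ x in I, f x) = 1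

/-- The measure on `ℝ` with density `f` on `I`. -/
noncomputable def densityMeasure (I : Set ℝ) (f : ℝ → ℝ) : Measure ℝ :=
  (volume.restrict I).withDensity fun x => ENNReal.ofReal (f x)

/-- The empirical distribution `μ_n = (1/n) ∑ᵢ δ_{Xᵢ}` of the sample vector `X`. -/
noncomputable def empMeasure (n : ℕ) (X : Fin n → ℝ) : Measure ℝ :=
  ∑ i, ((n : ENNReal))⁻¹ • Measure.dirac (X i)

theorem integral_exp_mul_le {P : Measure ℝ} [IsProbabilityMeasure P] {h : ℝ → ℝ}
    (hm : Measurable h) (hb : ∀ x, |h x| ≤ 1) {v l : ℝ} (hv : ∫ x, h x ^ 2 ∂P ≤ v)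
    (hl : 0 ≤ l) (hl1 : l ≤ 1) :
    ∫ x, Real.exp (l * h x) ∂P ≤ Real.exp (l * ∫ x, h x ∂P + l ^ 2 * v) := by
  have hi : Integrable h P := Integrable.of_bound hm.aestronglyMeasurable 1 (ae_of_all _ hb)
  have hi2 : Integrable (fun x => h x ^ 2) P :=
    Integrable.of_bound (hm.pow_const 2).aestronglyMeasurable 1 (ae_of_all _ fun x => by
      rw [Real.norm_eq_abs, abs_pow]; exact pow_le_one₀ (abs_nonneg _) (hb x))
  have habs : ∀ x, |l * h x| ≤ 1 := fun x => by
    rw [abs_mul, abs_of_nonneg hl]; exact mul_le_one₀ hl1 (abs_nonneg _) (hb x)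
  have hie : Integrable (fun x => Real.exp (l * h x)) P :=
    Integrable.of_bound (by fun_prop) (Real.exp 1) (ae_of_all _ fun x => by
      rw [Real.norm_eq_abs, Real.abs_exp]
      exact Real.exp_le_exp.2 ((le_abs_self _).trans (habs x)))
  calc ∫ x, Real.exp (l * h x) ∂P ≤ ∫ x, (1 + l * h x + l ^ 2 * h x ^ 2) ∂P := by
        refine integral_mono hie (((integrable_const _).add (hi.const_mul l)).add
          (hi2.const_mul _)) fun x => ?_
        have := (abs_le.1 (Real.abs_exp_sub_one_sub_id_le (habs x))).2
        simp only
        nlinarith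
    _ = 1 + l * ∫ x, h x ∂P + l ^ 2 * ∫ x, h x ^ 2 ∂P := by
        rw [integral_add (f := fun x => 1 + l * h x)
          ((integrable_const _).add (hi.const_mul l)) (hi2.const_mul _),
          integral_add (integrable_const _) (hi.const_mul l), integral_const_mul,
          integral_const_mul]
        simp
    _ ≤ 1 + (l * ∫ x, h x ∂P + l ^ 2 * v) := by
        nlinarith [mul_le_mul_of_nonneg_left hv (sq_nonneg l)]
    _ ≤ _ := by rw [add_comm]; exact Real.add_one_le_exp _

/-- A Bernstein-type tail bound for the empirical mean of a bounded function. -/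
theorem measure_pi_tail_le {P : Measure ℝ} [IsProbabilityMeasure P] {h : ℝ → ℝ}
    (hm : Measurable h) (hb : ∀ x, |h x| ≤ 1) {v l : ℝ} (hv : ∫ x, h x ^ 2 ∂P ≤ v)
    (hl : 0 < l) (hl1 : l ≤ 1) (n : ℕ) (t : ℝ) :
    (Measure.pi fun _ : Fin n => P).real {X | n * (t + ∫ x, h x ∂P) ≤ ∑ i, h (X i)} ≤
      Real.exp (n * (l ^ 2 * v - l * t)) := by
  have hie : Integrable (fun x => Real.exp (l * h x)) P :=
    Integrable.of_bound (by fun_prop) (Real.exp 1) (ae_of_all _ fun x => by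
      rw [Real.norm_eq_abs, Real.abs_exp]
      refine Real.exp_le_exp.2 ((le_abs_self _).trans ?_)
      rw [abs_mul, abs_of_nonneg hl.le]; exact mul_le_one₀ hl1 (abs_nonneg _) (hb x))
  have key := mul_meas_ge_le_integral_of_nonneg (μ := Measure.pi fun _ : Fin n => P)
    (f := fun X => ∏ i, Real.exp (l * h (X i)))
    (ae_of_all _ fun X => Finset.prod_nonneg fun i _ => (Real.exp_pos _).le)
    (Integrable.fintype_prod fun _ => hie) (Real.exp (l * (n * (t + ∫ x, h x ∂P))))
  rw [integral_fintype_prod_eq_pow (fun x => Real.exp (l * h x)), Fintype.card_fin] at key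
  have hset : {X : Fin n → ℝ | Real.exp (l * (n * (t + ∫ x, h x ∂P))) ≤
      ∏ i, Real.exp (l * h (X i))} = {X | n * (t + ∫ x, h x ∂P) ≤ ∑ i, h (X i)} := by
    ext X
    simp only [mem_ofPred_eq]
    rw [← Real.exp_sum, Real.exp_le_exp, ← Finset.mul_sum, mul_le_mul_iff_right₀ hl]
  rw [hset] at key
  have h2 := pow_le_pow_left₀ (integral_nonneg fun x => (Real.exp_pos _).le)
    (integral_exp_mul_le hm hb hv hl.le hl1) n
  rw [← Real.exp_nat_mul] at h2
  rw [← mul_le_mul_iff_right₀ (Real.exp_pos (l * (n * (t + ∫ x, h x ∂P)))), ← Real.exp_add]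
  refine (key.trans h2).trans (Real.exp_le_exp.2 (le_of_eq ?_))
  ring

theorem card_sign_support_le (M m : ℕ) {x : ℝ} (hx : 0 < x) (hx1 : x ≤ 1) :
    ((Finset.univ.filter fun s : Fin M → SignType =>
      (Finset.univ.filter fun c => s c ≠ 0).card ≤ m).card : ℝ) * x ^ m ≤ (1 + 2 * x) ^ M := by
  classical
  have hsum : (1 + 2 * x) ^ M =
      ∑ s : Fin M → SignType, x ^ (Finset.univ.filter fun c => s c ≠ 0).card := by
    have := Fintype.prod_sum (ι := Fin M) (κ := fun _ => SignType)
      (fun _ a => if a ≠ 0 then x else 1)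
    have h1 : ∑ a : SignType, (if a ≠ 0 then x else 1) = 1 + 2 * x := by
      have : (Finset.univ : Finset SignType) = {0, -1, 1} := by decide
      rw [this]
      simp
      ring
    rw [h1, Finset.prod_const, Finset.card_univ, Fintype.card_fin] at this
    rw [this]
    refine Finset.sum_congr rfl fun s _ => ?_
    rw [Finset.prod_ite]
    simp
  rw [hsum, ← nsmul_eq_mul]
  refine (Finset.card_nsmul_le_sum _ _ _ fun s hs => ?_).trans
    (Finset.sum_le_sum_of_subset_of_nonneg (Finset.filter_subset _ _)
      fun _ _ _ => by positivity)
  exact pow_le_pow_of_le_one hx.le hx1 (Finset.mem_filter.1 hs).2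

theorem measure_cdf_preimage_Ico_le {P : Measure ℝ} [IsProbabilityMeasure P] [NullSingletonClass P]
    {a b : ℝ} (hab : a ≤ b) : P.real {x | a ≤ P.real (Iic x) ∧ P.real (Iic x) < b} ≤ b - a := by
  have hmono : Monotone fun x => P.real (Iic x) := fun x y hxy =>
    measureReal_mono (Iic_subset_Iic.2 hxy)
  have hmeas : MeasurableSet {x | a ≤ P.real (Iic x) ∧ P.real (Iic x) < b} :=
    (measurableSet_le measurable_const hmono.measurable).inter
      (measurableSet_lt hmono.measurable measurable_const)
  rw [Measure.real, hmeas.measure_eq_iSup_isCompact]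
  refine ENNReal.toReal_le_of_le_ofReal (by linarith) ?_
  refine iSup_le fun K => iSup_le fun hK => iSup_le fun hKc => ?_
  rcases K.eq_empty_or_nonempty with rfl | hne
  · simp
  have h1 := hK (hKc.sInf_mem hne)
  have h2 := hK (hKc.sSup_mem hne)
  have hle : sInf K ≤ sSup K := csInf_le_csSup hne hKc.bddBelow hKc.bddAbove
  have hsub : K ⊆ Icc (sInf K) (sSup K) := fun x hx =>
    ⟨csInf_le hKc.bddBelow hx, le_csSup hKc.bddAbove hx⟩
  refine (measure_mono hsub).trans ?_
  rw [← measure_congr (Ioc_ae_eq_Icc (μ := P)), ← ofReal_measureReal]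
  refine ENNReal.ofReal_le_ofReal ?_
  rw [← Iic_sdiff_Iic, measureReal_sdiff (Iic_subset_Iic.2 hle) measurableSet_Iic]
  linarith [h1.1, h2.2]

theorem exists_card_le_two {E : Set ℕ} (hE : ∀ a ∈ E, ∀ b ∈ E, ∀ c ∈ E, a < b → b < c → False) :
    ∃ T : Finset ℕ, T.card ≤ 2 ∧ E ⊆ T := by
  rcases E.eq_empty_or_nonempty with rfl | hne
  · exact ⟨∅, by simp⟩
  rcases (E \ {sInf E}).eq_empty_or_nonempty with h | h
  · exact ⟨{sInf E}, by simp, by simpa [sdiff_eq_empty] using h⟩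
  refine ⟨{sInf E, sInf (E \ {sInf E})}, Finset.card_le_two, fun c hc => ?_⟩
  by_contra hcon
  simp only [Finset.coe_insert, Finset.coe_singleton, mem_insert_iff, mem_singleton_iff,
    not_or] at hcon
  have h1 := Nat.sInf_mem hne
  have h2 := Nat.sInf_mem h
  have h3 : sInf (E \ {sInf E}) ≤ c := Nat.sInf_le ⟨hc, hcon.1⟩
  exact hE _ h1 _ h2.1 c hc (lt_of_le_of_ne (Nat.sInf_le h2.1) (Ne.symm h2.2))
    (lt_of_le_of_ne h3 (Ne.symm hcon.2))

/-- The union of the fibres of `φ` that are contained in `A`. -/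
def fibreInterior (φ : ℝ → ℕ) (A : Set ℝ) : Set ℝ := {x | ∀ y, φ y = φ x → y ∈ A}

theorem fibreInterior_subset (φ : ℝ → ℕ) (A : Set ℝ) : fibreInterior φ A ⊆ A :=
  fun _ hx => hx _ rfl

theorem measurableSet_fibreInterior {φ : ℝ → ℕ} (hφ : Measurable φ) (A : Set ℝ) :
    MeasurableSet (fibreInterior φ A) := by
  have : fibreInterior φ A = φ ⁻¹' {c | ∀ y, φ y = c → y ∈ A} := rfl
  rw [this]
  exact hφ (MeasurableSet.of_discrete)

theorem exists_boundary_fibres {φ : ℝ → ℕ} (hφ : Monotone φ) {A : Set ℝ} (hA : A.OrdConnected) :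
    ∃ T : Finset ℕ, T.card ≤ 2 ∧ ∀ x ∈ A \ fibreInterior φ A, φ x ∈ T := by
  obtain ⟨T, hT, hsub⟩ := exists_card_le_two (E := φ '' (A \ fibreInterior φ A)) (by
    rintro _ ⟨x, hx, rfl⟩ _ ⟨y, hy, rfl⟩ _ ⟨z, hz, rfl⟩ hxy hyz
    refine hy.2 fun w hw => hA.out hx.1 hz.1 ⟨?_, ?_⟩
    · exact (hφ.reflect_lt (hw ▸ hxy)).le
    · exact (hφ.reflect_lt (hw ▸ hyz)).le)
  exact ⟨T, hT, fun x hx => hsub ⟨x, hx, rfl⟩⟩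

theorem exists_sign_eq_sum_indicator {k : ℕ} {E : Fin k → Set ℕ}
    (hE : Pairwise fun i j => Disjoint (E i) (E j)) (σ : Fin k → SignType) :
    ∃ s : ℕ → SignType, (∀ c, (s c : ℝ) = ∑ i, (σ i : ℝ) * (E i).indicator 1 c) ∧
      ∀ c, s c ≠ 0 → ∃ i, c ∈ E i := by
  classical
  refine ⟨fun c => if h : ∃ i, c ∈ E i then σ h.choose else 0, fun c => ?_, fun c hc => ?_⟩
  · by_cases h : ∃ i, c ∈ E i
    · simp only [dif_pos h]
      rw [Finset.sum_eq_single h.choose]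
      · simp [indicator_of_mem h.choose_spec]
      · intro i _ hi
        rw [indicator_of_notMem, mul_zero]
        exact fun hci => (hE hi).le_bot ⟨hci, h.choose_spec⟩
      · simp
    · simp only [dif_neg h]
      push Not at h
      simp [h]
  · by_contra h
    simp [h] at hc

theorem sum_sign_mul_preimage_le {P ν : Measure ℝ} [IsProbabilityMeasure P]
    [IsProbabilityMeasure ν] {φ : ℝ → ℕ} (hφ : Measurable φ) {m : ℕ} {t : ℝ}
    (good : ∀ (s : ℕ → SignType) (T : Finset ℕ), T.card ≤ m → (∀ c ∉ T, s c = 0) →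
      ∫ x, (s (φ x) : ℝ) ∂ν - ∫ x, (s (φ x) : ℝ) ∂P ≤ t)
    {k : ℕ} {E : Fin k → Set ℕ} (hE : Pairwise fun i j => Disjoint (E i) (E j))
    (σ : Fin k → SignType) {T : Finset ℕ} (hT : T.card ≤ m) (hET : ∀ i, E i ⊆ T) :
    ∑ i, (σ i : ℝ) * (ν.real (φ ⁻¹' E i) - P.real (φ ⁻¹' E i)) ≤ t := by
  obtain ⟨s, hs, hs0⟩ := exists_sign_eq_sum_indicator hE σ
  have hint : ∀ (μ : Measure ℝ) [IsProbabilityMeasure μ],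
      ∫ x, (s (φ x) : ℝ) ∂μ = ∑ i, (σ i : ℝ) * μ.real (φ ⁻¹' E i) := by
    intro μ _
    have hm : ∀ i, MeasurableSet (φ ⁻¹' E i) := fun i => hφ MeasurableSet.of_discrete
    have heq : ∀ i x, (E i).indicator (1 : ℕ → ℝ) (φ x) = (φ ⁻¹' E i).indicator 1 x :=
      fun i x => rfl
    simp_rw [hs, heq]
    rw [integral_finsetSum]
    · refine Finset.sum_congr rfl fun i _ => ?_
      rw [integral_const_mul, integral_indicator_one (hm i)]
    · intro i _
      exact ((integrable_const (1 : ℝ)).indicator (hm i)).const_mul _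
  have := good s T hT fun c hc => by
    by_contra h
    obtain ⟨i, hi⟩ := hs0 c h
    exact hc (hET i hi)
  rw [hint ν, hint P, ← Finset.sum_sub_distrib] at this
  simpa only [mul_sub] using this

/-- Chaining over nested partitions into fibres of monotone functions. -/
theorem sum_abs_measure_sub_le {P ν : Measure ℝ} [IsProbabilityMeasure P]
    [IsProbabilityMeasure ν] {φ : ℕ → ℝ → ℕ} (hmono : ∀ j, Monotone (φ j))
    (hhalf : ∀ j x, φ j x = φ (j + 1) x / 2) {k : ℕ} (hk : 0 < k) (h0 : ∀ x, φ 0 x ≤ k)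
    {J : ℕ} {t : ℕ → ℝ} {p : ℝ} (hp : ∀ c, P.real (φ J ⁻¹' {c}) ≤ p)
    (good : ∀ j ≤ J, ∀ (s : ℕ → SignType) (T : Finset ℕ), T.card ≤ 4 * k →
      (∀ c ∉ T, s c = 0) →
      ∫ x, (s (φ j x) : ℝ) ∂ν - ∫ x, (s (φ j x) : ℝ) ∂P ≤ t j)
    {I : Fin k → Set ℝ} (hI : ∀ i, (I i).OrdConnected)
    (hd : Pairwise fun i j => Disjoint (I i) (I j)) :
    ∑ i, |ν.real (I i) - P.real (I i)| ≤
      ∑ j ∈ Finset.range (J + 1), t j + (t J + 4 * k * p) := by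
  classical
  have hφm : ∀ j, Measurable (φ j) := fun j => (hmono j).measurable
  set σ : Fin k → SignType := fun i => SignType.sign (ν.real (I i) - P.real (I i))
  set A : ℕ → Fin k → Set ℝ := fun j i => fibreInterior (φ j) (I i)
  have hAm : ∀ j i, MeasurableSet (A j i) := fun j i => measurableSet_fibreInterior (hφm j) _
  have hAI : ∀ j i, A j i ⊆ I i := fun j i => fibreInterior_subset _ _
  have hsat : ∀ j i x y, x ∈ A j i → φ j y = φ j x → y ∈ A j i := fun j i x y hx hy z hz =>
    hx z (hz.trans hy)
  have hAmono : ∀ j i, A j i ⊆ A (j + 1) i := fun j i x hx y hy =>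
    hx y (by rw [hhalf j y, hhalf j x, hy])
  choose B hBc hB using fun j i => exists_boundary_fibres (hmono j) (hI i)
  have level : ∀ j ≤ J, ∑ i, (σ i : ℝ) * (ν.real (A j i) - P.real (A j i)) ≤
      ∑ l ∈ Finset.range (j + 1), t l := by
    intro j
    induction j with
    | zero =>
      intro _
      have himg : ∀ i, φ 0 ⁻¹' (φ 0 '' A 0 i) = A 0 i := fun i =>
        Subset.antisymm (fun x ⟨y, hy, hxy⟩ => hsat 0 i y x hy hxy.symm) (subset_preimage_image _ _)
      have := sum_sign_mul_preimage_le (hφm 0) (good 0 (Nat.zero_le _))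
        (E := fun i => φ 0 '' A 0 i) (fun i i' hii => Set.disjoint_left.2 (by
          rintro _ ⟨x, hx, rfl⟩ ⟨y, hy, hxy⟩
          exact (hd hii).le_bot ⟨hAI _ _ hx, hAI _ _ (hsat 0 i' y x hy hxy.symm)⟩)) σ
        (T := Finset.range (k + 1)) (by rw [Finset.card_range]; omega) (by
          rintro i _ ⟨x, _, rfl⟩
          have := h0 x
          simp only [Finset.coe_range, mem_Iio]
          omega)
      simpa [himg] using this
    | succ j ih =>
      intro hj
      have ih := ih (by omega)
      set D : Fin k → Set ℝ := fun i => A (j + 1) i \ A j i with hD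
      have himg : ∀ i, φ (j + 1) ⁻¹' (φ (j + 1) '' D i) = D i := fun i =>
        Subset.antisymm (fun x ⟨y, hy, hxy⟩ => ⟨hsat (j + 1) i y x hy.1 hxy.symm, fun hx =>
          hy.2 (hsat j i x y hx (by rw [hhalf j y, hhalf j x, hxy]))⟩) (subset_preimage_image _ _)
      have := sum_sign_mul_preimage_le (hφm (j + 1)) (good (j + 1) hj)
        (E := fun i => φ (j + 1) '' D i) (fun i i' hii => Set.disjoint_left.2 (by
          rintro _ ⟨x, hx, rfl⟩ ⟨y, hy, hxy⟩
          exact (hd hii).le_bot ⟨hAI _ _ hx.1,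
            hAI _ _ (hsat (j + 1) i' y x hy.1 hxy.symm)⟩)) σ
        (T := Finset.univ.biUnion fun i => (B j i).biUnion fun d => {2 * d, 2 * d + 1}) (by
          refine (Finset.card_biUnion_le_card_mul _ _ 4 fun i _ => ?_).trans (by simp [mul_comm])
          refine (Finset.card_biUnion_le_card_mul _ _ 2 fun d _ => Finset.card_le_two).trans ?_
          have := hBc j i
          omega) (by
          rintro i _ ⟨x, hx, rfl⟩
          simp only [Finset.coe_biUnion, mem_iUnion]
          refine ⟨i, Finset.mem_univ _, φ j x, hB j i x ⟨hAI _ _ hx.1, hx.2⟩, ?_⟩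
          simp only [Finset.coe_insert, Finset.coe_singleton, mem_insert_iff, mem_singleton_iff]
          have := hhalf j x
          omega)
      simp only [himg] at this
      rw [Finset.sum_range_succ]
      refine le_trans (le_of_eq ?_) (add_le_add ih this)
      rw [← Finset.sum_add_distrib]
      refine Finset.sum_congr rfl fun i _ => ?_
      rw [hD, measureReal_sdiff (hAmono j i) (hAm j i), measureReal_sdiff (hAmono j i) (hAm j i)]
      ring
  set R : Fin k → Set ℝ := fun i => I i \ A J i with hR
  have hRm : ∀ i, MeasurableSet (R i) := fun i => (hI i).measurableSet.diff (hAm J i)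
  set T : Finset ℕ := Finset.univ.biUnion fun i => B J i with hT
  have hTc : T.card ≤ 2 * k :=
    (Finset.card_biUnion_le_card_mul _ _ 2 fun i _ => hBc J i).trans (by simp [mul_comm])
  have hrest : ∀ (μ : Measure ℝ) [IsProbabilityMeasure μ],
      ∑ i, μ.real (R i) ≤ μ.real (φ J ⁻¹' T) := by
    intro μ _
    rw [← measureReal_biUnion_finset (fun i _ i' _ hii =>
      (hd hii).mono sdiff_subset sdiff_subset) (fun i _ => hRm i)]
    refine measureReal_mono (iUnion₂_subset fun i _ x hx => ?_)
    simp only [hT, mem_preimage, Finset.coe_biUnion, mem_iUnion]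
    exact ⟨i, Finset.mem_univ _, hB J i x hx⟩
  have hPT : P.real (φ J ⁻¹' T) ≤ 2 * k * p := by
    have hp0 : 0 ≤ p := measureReal_nonneg.trans (hp 0)
    have : φ J ⁻¹' T = ⋃ c ∈ T, φ J ⁻¹' {c} := by ext; simp
    rw [this]
    refine (measureReal_biUnion_finset_le _ _).trans ((Finset.sum_le_card_nsmul _ _ p
      fun c _ => hp c).trans ?_)
    rw [nsmul_eq_mul]
    exact mul_le_mul_of_nonneg_right (by exact_mod_cast hTc) hp0
  have hνT : ν.real (φ J ⁻¹' T) - P.real (φ J ⁻¹' T) ≤ t J := by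
    have := sum_sign_mul_preimage_le (k := 1) (hφm J) (good J le_rfl) (E := fun _ => (T : Set ℕ))
      (fun i j hij => absurd (Subsingleton.elim i j) hij) (fun _ => 1) (T := T) (by omega)
      (fun _ => subset_rfl)
    simpa using this
  have hσle : ∀ i a, (σ i : ℝ) * a ≤ |a| := fun i a => by
    rcases h : σ i with _ | _ | _
    · simp [abs_nonneg]
    · simpa using neg_le_abs a
    · simpa using le_abs_self a
  have hsplit : ∀ i, |ν.real (I i) - P.real (I i)| ≤
      (σ i : ℝ) * (ν.real (A J i) - P.real (A J i)) + (ν.real (R i) + P.real (R i)) := by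
    intro i
    rw [← sign_mul_self (ν.real (I i) - P.real (I i))]
    change (σ i : ℝ) * _ ≤ _
    have h1 : ∀ (μ : Measure ℝ) [IsProbabilityMeasure μ],
        μ.real (I i) = μ.real (A J i) + μ.real (R i) := fun μ _ => by
      rw [hR, measureReal_sdiff (hAI J i) (hAm J i)]; ring
    have h2 := hσle i (ν.real (R i) - P.real (R i))
    have h3 : |ν.real (R i) - P.real (R i)| ≤ ν.real (R i) + P.real (R i) :=
      abs_le.2 ⟨by linarith [measureReal_nonneg (μ := ν) (s := R i)],
        by linarith [measureReal_nonneg (μ := P) (s := R i)]⟩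
    rw [h1 ν, h1 P]
    linarith
  refine (Finset.sum_le_sum fun i _ => hsplit i).trans ?_
  rw [Finset.sum_add_distrib, Finset.sum_add_distrib]
  linarith [level J le_rfl, hrest ν, hrest P]

theorem isProbabilityMeasure_empMeasure {n : ℕ} (hn : 0 < n) (X : Fin n → ℝ) :
    IsProbabilityMeasure (empMeasure n X) := by
  refine ⟨?_⟩
  simp only [empMeasure, Measure.coe_finsetSum, Finset.sum_apply, Measure.smul_apply, measure_univ,
    smul_eq_mul, mul_one, Finset.sum_const, Finset.card_univ, Fintype.card_fin, nsmul_eq_mul]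
  exact ENNReal.mul_inv_cancel (by exact_mod_cast hn.ne') (ENNReal.natCast_ne_top n)

theorem integral_empMeasure (n : ℕ) (X : Fin n → ℝ) (h : ℝ → ℝ) :
    ∫ x, h x ∂(empMeasure n X) = (n : ℝ)⁻¹ * ∑ i, h (X i) := by
  rcases n.eq_zero_or_pos with rfl | hn
  · simp [empMeasure]
  rw [empMeasure, integral_finsetSum_measure]
  · simp [integral_smul_measure, Finset.mul_sum]
  · intro i _
    exact (integrable_dirac (by simp)).smul_measure (by simp [hn.ne'])

theorem isProbabilityMeasure_densityMeasure {I : Set ℝ} {f : ℝ → ℝ} (hI : MeasurableSet I)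
    (hf : IsPDFOn f I) : IsProbabilityMeasure (densityMeasure I f) := by
  refine ⟨?_⟩
  rw [densityMeasure, withDensity_apply _ MeasurableSet.univ, Measure.restrict_univ,
    ← ofReal_integral_eq_lintegral_ofReal hf.2.1 (ae_restrict_of_forall_mem hI hf.1), hf.2.2,
    ENNReal.ofReal_one]

theorem densityMeasure_real_eq {I : Set ℝ} {f : ℝ → ℝ} (hf : IsPDFOn f I) {A : Set ℝ}
    (hA : MeasurableSet A) (hAI : A ⊆ I) : (densityMeasure I f).real A = ∫ x in A, f x := by
  have hnn : 0 ≤ᵐ[volume.restrict A] f :=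
    ae_restrict_of_forall_mem hA fun x hx => hf.1 x (hAI hx)
  rw [Measure.real, densityMeasure, withDensity_apply _ hA, Measure.restrict_restrict hA,
    inter_eq_self_of_subset_left hAI,
    ← ofReal_integral_eq_lintegral_ofReal (hf.2.1.mono_set hAI) hnn,
    ENNReal.toReal_ofReal (integral_nonneg_of_ae hnn)]

theorem measure_exists_sign_deviation_le {P : Measure ℝ} [IsProbabilityMeasure P] {φ : ℝ → ℕ}
    (hφ : Measurable φ) {M m n : ℕ} (hn : 0 < n) (hM : ∀ x, φ x ≤ M) {p l x : ℝ}
    (hp : ∀ c, P.real (φ ⁻¹' {c}) ≤ p) (hl : 0 < l) (hl1 : l ≤ 1) (hx : 0 < x) (hx1 : x ≤ 1)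
    (t : ℝ) :
    (Measure.pi fun _ : Fin n => P).real {X | ∃ (s : ℕ → SignType) (T : Finset ℕ), T.card ≤ m ∧
      (∀ c ∉ T, s c = 0) ∧
      t < ∫ x, (s (φ x) : ℝ) ∂(empMeasure n X) - ∫ x, (s (φ x) : ℝ) ∂P} ≤
      (1 + 2 * x) ^ (M + 1) / x ^ m * Real.exp (n * (l ^ 2 * (m * p) - l * t)) := by
  classical
  set ψ : ℝ → Fin (M + 1) := fun x => ⟨φ x, Nat.lt_succ_of_le (hM x)⟩ with hψ
  have hψm : Measurable ψ := measurable_to_countable' fun c => by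
    have : ψ ⁻¹' {c} = φ ⁻¹' {(c : ℕ)} := by ext x; simp [hψ, Fin.ext_iff]
    rw [this]
    exact hφ (measurableSet_singleton _)
  set S := Finset.univ.filter fun s : Fin (M + 1) → SignType =>
      (Finset.univ.filter fun c => s c ≠ 0).card ≤ m
  have htail : ∀ s ∈ S, (Measure.pi fun _ : Fin n => P).real
      {X | n * (t + ∫ x, (s (ψ x) : ℝ) ∂P) ≤ ∑ i, (s (ψ (X i)) : ℝ)} ≤
      Real.exp (n * (l ^ 2 * (m * p) - l * t)) := by
    intro s hs
    refine measure_pi_tail_le (h := fun x => (s (ψ x) : ℝ)) ?_ ?_ ?_ hl hl1 n t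
    · exact (Measurable.of_discrete (f := fun c : Fin (M + 1) => (s c : ℝ))).comp hψm
    · intro x
      rcases s (ψ x) with _ | _ | _ <;> simp
    · set U := Finset.univ.filter fun c => s c ≠ 0 with hU
      have heq : (fun x => (s (ψ x) : ℝ) ^ 2) = (ψ ⁻¹' U).indicator 1 := by
        funext x
        by_cases h : s (ψ x) = 0
        · rw [indicator_of_notMem (by simp [hU, h]), h]
          simp
        · rw [indicator_of_mem (by simp [hU, h])]
          revert h
          rcases s (ψ x) with _ | _ | _ <;> simp
      have hp0 : 0 ≤ p := measureReal_nonneg.trans (hp 0)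
      rw [heq, integral_indicator_one (hψm MeasurableSet.of_discrete)]
      have : ψ ⁻¹' U = ⋃ c ∈ U, φ ⁻¹' {(c : ℕ)} := by
        ext x
        simp only [mem_preimage, mem_iUnion, mem_singleton_iff, exists_prop]
        exact ⟨fun h => ⟨_, h, rfl⟩, fun ⟨c, hc, h⟩ =>
          (Fin.ext h : ψ x = c) ▸ hc⟩
      rw [this]
      refine (measureReal_biUnion_finset_le _ _).trans ((Finset.sum_le_card_nsmul _ _ p
        fun (c : Fin (M + 1)) _ => hp c).trans ?_)
      rw [nsmul_eq_mul]
      exact mul_le_mul_of_nonneg_right (by exact_mod_cast (Finset.mem_filter.1 hs).2) hp0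
  have hcard : (S.card : ℝ) ≤ (1 + 2 * x) ^ (M + 1) / x ^ m := by
    rw [le_div_iff₀ (by positivity)]
    exact card_sign_support_le (M + 1) m hx hx1
  refine le_trans ?_ (mul_le_mul_of_nonneg_right hcard (Real.exp_pos _).le)
  rw [← nsmul_eq_mul]
  refine le_trans ?_ (Finset.sum_le_card_nsmul _ _ _ htail)
  refine le_trans (measureReal_mono ?_ (measure_ne_top _ _)) (measureReal_biUnion_finset_le _ _)
  rintro X ⟨s, T, hT, hs, hX⟩
  simp only [mem_iUnion]
  refine ⟨fun c => s c, ?_, ?_⟩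
  · refine Finset.mem_filter.2 ⟨Finset.mem_univ _, le_trans ?_ hT⟩
    refine Finset.card_le_card_of_injOn (fun c => (c : ℕ)) (fun c hc => ?_)
      (fun a _ b _ h => Fin.ext h)
    by_contra h
    exact (Finset.mem_filter.1 hc).2 (hs _ h)
  · rw [integral_empMeasure] at hX
    have hn' : (0 : ℝ) < n := by exact_mod_cast hn
    have h1 : t + ∫ x, (s (φ x) : ℝ) ∂P ≤ (n : ℝ)⁻¹ * ∑ i, (s (φ (X i)) : ℝ) := by linarith
    have h2 := mul_le_mul_of_nonneg_left h1 hn'.le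
    rwa [mul_inv_cancel_left₀ hn'.ne'] at h2

/-- The index of the cell containing `x` when the range of the distribution function of `P` is
cut into pieces of length `1 / (k * 2 ^ j)`. -/
noncomputable def cellIndex (P : Measure ℝ) (k j : ℕ) (x : ℝ) : ℕ :=
  ⌊(k * 2 ^ j : ℝ) * P.real (Iic x)⌋₊

theorem monotone_cellIndex (P : Measure ℝ) [IsProbabilityMeasure P] (k j : ℕ) :
    Monotone (cellIndex P k j) := fun x y hxy =>
  Nat.floor_mono (mul_le_mul_of_nonneg_left (measureReal_mono (Iic_subset_Iic.2 hxy))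
    (by positivity))

theorem cellIndex_eq_div_two (P : Measure ℝ) (k j : ℕ) (x : ℝ) :
    cellIndex P k j x = cellIndex P k (j + 1) x / 2 := by
  rw [cellIndex, cellIndex, ← Nat.floor_div_ofNat]
  congr 1
  rw [pow_succ]
  simp only [OfNat.ofNat]
  push_cast
  ring

theorem cellIndex_le (P : Measure ℝ) [IsProbabilityMeasure P] (k j : ℕ) (x : ℝ) :
    cellIndex P k j x ≤ k * 2 ^ j := by
  refine Nat.floor_le_of_le ?_
  push_cast
  exact mul_le_of_le_one_right (by positivity) measureReal_le_one

theorem measure_cellIndex_preimage_le {P : Measure ℝ} [IsProbabilityMeasure P]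
    [NullSingletonClass P] {k : ℕ} (hk : 0 < k) (j c : ℕ) :
    P.real (cellIndex P k j ⁻¹' {c}) ≤ 1 / (k * 2 ^ j) := by
  have hN : (0 : ℝ) < k * 2 ^ j := by positivity
  have hsub : cellIndex P k j ⁻¹' {c} ⊆ {x | (c / (k * 2 ^ j) : ℝ) ≤ P.real (Iic x) ∧
      P.real (Iic x) < ((c + 1) / (k * 2 ^ j) : ℝ)} := by
    intro x hx
    have h := (Nat.floor_eq_iff (mul_nonneg hN.le measureReal_nonneg)).1 hx
    exact ⟨(div_le_iff₀' hN).2 h.1, (lt_div_iff₀' hN).2 h.2⟩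
  refine (measureReal_mono hsub).trans ((measure_cdf_preimage_Ico_le ?_).trans (le_of_eq ?_))
  · gcongr; linarith
  · ring

theorem sum_two_thirds_pow_le (m : ℕ) : ∑ j ∈ Finset.range m, (2 / 3 : ℝ) ^ j ≤ 3 := by
  have : ∑ j ∈ Finset.range m, (2 / 3 : ℝ) ^ j = 3 - 3 * (2 / 3) ^ m := by
    induction m with
    | zero => simp
    | succ m ih => rw [Finset.sum_range_succ, ih, pow_succ]; ring
  rw [this]
  have : (0 : ℝ) ≤ (2 / 3) ^ m := by positivity
  linarith

theorem sum_succ_mul_three_quarters_pow_le (m : ℕ) :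
    ∑ j ∈ Finset.range m, ((j : ℝ) + 1) * (3 / 4) ^ j ≤ 16 := by
  have : ∑ j ∈ Finset.range m, ((j : ℝ) + 1) * (3 / 4) ^ j = 16 - (4 * m + 16) * (3 / 4) ^ m := by
    induction m with
    | zero => simp
    | succ m ih => rw [Finset.sum_range_succ, ih, pow_succ]; push_cast; ring
  rw [this]
  have : (0 : ℝ) ≤ (4 * m + 16) * (3 / 4) ^ m := by positivity
  linarith

theorem sum_half_pow_succ_le (m : ℕ) : ∑ j ∈ Finset.range m, (1 / 2 : ℝ) ^ (j + 1) ≤ 1 := by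
  have : ∑ j ∈ Finset.range m, (1 / 2 : ℝ) ^ (j + 1) = 1 - (1 / 2) ^ m := by
    induction m with
    | zero => simp
    | succ m ih => rw [Finset.sum_range_succ, ih]; ring
  rw [this]
  have : (0 : ℝ) ≤ (1 / 2) ^ m := by positivity
  linarith

theorem two_le_exp_one : (2 : ℝ) ≤ Real.exp 1 := by
  have := Real.add_one_le_exp (1 : ℝ)
  linarith

/-- The Chernoff parameter used at level `j`. -/
noncomputable def chernoffRate (ε : ℝ) (j : ℕ) : ℝ := ε / 64 * (4 / 3) ^ j

/-- The deviation allowed at level `j`. -/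
noncomputable def levelDeviation (ε : ℝ) (j : ℕ) : ℝ :=
  ε / 16 * (2 / 3) ^ j + 5 * ε / 512 * ((j + 1) * (3 / 4) ^ j)

theorem levelDeviation_nonneg {ε : ℝ} (hε : 0 < ε) (j : ℕ) : 0 ≤ levelDeviation ε j := by
  unfold levelDeviation; positivity

theorem sum_levelDeviation_le {ε : ℝ} (hε : 0 < ε) (m : ℕ) :
    ∑ j ∈ Finset.range m, levelDeviation ε j ≤ 3 / 8 * ε := by
  unfold levelDeviation
  rw [Finset.sum_add_distrib, ← Finset.mul_sum, ← Finset.mul_sum]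
  nlinarith [mul_le_mul_of_nonneg_left (sum_two_thirds_pow_le m) hε.le,
    mul_le_mul_of_nonneg_left (sum_succ_mul_three_quarters_pow_le m) hε.le]

theorem chernoffRate_mul_levelDeviation (ε : ℝ) (j : ℕ) :
    chernoffRate ε j ^ 2 * (4 / 2 ^ j) - chernoffRate ε j * levelDeviation ε j =
      -(5 * (j + 1) * ε ^ 2 / 32768) := by
  unfold chernoffRate levelDeviation
  have h1 : (2 / 3 : ℝ) ^ j = (4 / 3) ^ j * (1 / 2 ^ j) := by
    rw [← one_div_pow, ← mul_pow]; norm_num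
  have h2 : (4 / 3 : ℝ) ^ j * (3 / 4) ^ j = 1 := by rw [← mul_pow]; norm_num
  rw [h1]
  linear_combination (-(5 * (j + 1) * ε ^ 2 / 32768)) * h2

theorem level_failure_bound {k n j : ℕ} {ε δ : ℝ} (hk : 0 < k) (hε : 0 < ε) (hδ : 0 < δ)
    (hδ1 : δ < 1) (hn : 32768 * (((k : ℝ) + Real.log (1 / δ)) / ε ^ 2) ≤ (n : ℝ)) :
    (1 + 2 * (1 / 2 ^ j : ℝ)) ^ (k * 2 ^ j + 1) / (1 / 2 ^ j : ℝ) ^ (4 * k) *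
      Real.exp (n * (chernoffRate ε j ^ 2 * ((4 * k : ℕ) * (1 / (k * 2 ^ j))) -
        chernoffRate ε j * levelDeviation ε j)) ≤ δ * (1 / 2) ^ (j + 1) := by
  have hk' : (1 : ℝ) ≤ k := by exact_mod_cast hk
  have hk0 : (k : ℝ) ≠ 0 := by positivity
  set L := Real.log (1 / δ) with hL
  have hL0 : 0 ≤ L := Real.log_nonneg (by rw [le_div_iff₀ hδ]; linarith)
  have hv : ((4 * k : ℕ) : ℝ) * (1 / (k * 2 ^ j)) = 4 / 2 ^ j := by
    push_cast; field_simp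
  rw [hv, chernoffRate_mul_levelDeviation]
  have hpow : (1 + 2 * (1 / 2 ^ j : ℝ)) ^ (k * 2 ^ j + 1) ≤ Real.exp (4 * k) := by
    have h1 : 1 + 2 * (1 / 2 ^ j : ℝ) ≤ Real.exp (2 * (1 / 2 ^ j)) := by
      rw [add_comm]; exact Real.add_one_le_exp _
    refine (pow_le_pow_left₀ (by positivity) h1 _).trans ?_
    rw [← Real.exp_nat_mul]
    refine Real.exp_le_exp.2 ?_
    have h2 : (1 / 2 ^ j : ℝ) ≤ 1 := by
      rw [← one_div_pow]; exact pow_le_one₀ (by norm_num) (by norm_num)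
    have h3 : ((k * 2 ^ j + 1 : ℕ) : ℝ) * (2 * (1 / 2 ^ j)) = 2 * k + 2 * (1 / 2 ^ j) := by
      push_cast; field_simp
    rw [h3]; linarith
  have hinv : 1 / (1 / 2 ^ j : ℝ) ^ (4 * k) ≤ Real.exp (4 * k * j) := by
    have : 1 / (1 / 2 ^ j : ℝ) ^ (4 * k) = 2 ^ (j * (4 * k)) := by
      rw [one_div_pow, one_div_one_div, ← pow_mul]
    rw [this]
    refine (pow_le_pow_left₀ (by norm_num) two_le_exp_one _).trans ?_
    rw [← Real.exp_nat_mul]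
    refine Real.exp_le_exp.2 (le_of_eq ?_)
    push_cast; ring
  have hnε : 32768 * ((k : ℝ) + L) ≤ n * ε ^ 2 := by
    rwa [← mul_div_assoc, div_le_iff₀ (by positivity)] at hn
  have hδe : δ = Real.exp (-L) := by
    rw [hL, one_div, Real.log_inv, neg_neg, Real.exp_log hδ]
  have hhalf : Real.exp (-((j : ℝ) + 1)) ≤ (1 / 2) ^ (j + 1) := by
    rw [Real.exp_neg, one_div, inv_pow]
    refine inv_anti₀ (by positivity) ?_
    refine (pow_le_pow_left₀ (by norm_num) two_le_exp_one _).trans ?_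
    rw [← Real.exp_nat_mul]
    refine Real.exp_le_exp.2 (le_of_eq ?_)
    push_cast; ring
  calc _ ≤ Real.exp (4 * k) * Real.exp (4 * k * j) *
        Real.exp (n * -(5 * (j + 1) * ε ^ 2 / 32768)) := by
        rw [div_eq_mul_one_div]
        gcongr
    _ ≤ Real.exp (-L) * Real.exp (-((j : ℝ) + 1)) := by
        rw [← Real.exp_add, ← Real.exp_add, ← Real.exp_add]
        refine Real.exp_le_exp.2 ?_
        have hj : (0 : ℝ) ≤ j := Nat.cast_nonneg j
        have h1 := mul_le_mul_of_nonneg_left hnε (show (0 : ℝ) ≤ 5 * (j + 1) / 32768 by positivity)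
        nlinarith [mul_nonneg hj hL0, mul_nonneg hj (sub_nonneg.2 hk')]
    _ ≤ δ * (1 / 2) ^ (j + 1) := by
        rw [← hδe]; gcongr

theorem chernoffRate_le_one {ε : ℝ} (hε : 0 < ε) {J j : ℕ} (hj : j ≤ J)
    (hJ : ε * 2 ^ J ≤ 64) : chernoffRate ε j ≤ 1 := by
  have : (4 / 3 : ℝ) ^ j ≤ 2 ^ J :=
    (pow_le_pow_left₀ (by norm_num) (by norm_num) j).trans (pow_le_pow_right₀ (by norm_num) hj)
  unfold chernoffRate
  nlinarith [mul_le_mul_of_nonneg_left this hε.le]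

/-- There is a universal constant `C > 0` such that for every pdf `f` on an interval `I`,
every positive integer `k`, every `ε, δ ∈ (0,1)`, and every `n ≥ C·(k + log(1/δ))/ε²`:
if `X₁, …, X_n` are drawn i.i.d. from the distribution with density `f`, then with
probability at least `1 − δ`, `‖μ_n − f‖_{A_k} ≤ ε`. -/
theorem stmt15 : ∃ C : ℝ, 0 < C ∧
    ∀ (I : Set ℝ) (f : ℝ → ℝ) (k n : ℕ) (ε δ : ℝ),
      I.OrdConnected → MeasurableSet I → IsPDFOn f I → 0 < k →
      0 < ε → ε < 1 → 0 < δ → δ < 1 →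
      C * (((k : ℝ) + Real.log (1 / δ)) / ε ^ 2) ≤ (n : ℝ) →
      ENNReal.ofReal (1 - δ) ≤
        (Measure.pi fun _ : Fin n => densityMeasure I f)
          {X | akDist k I f (empMeasure n X) ≤ ε} := by
  refine ⟨32768, by norm_num, fun I f k n ε δ _ hIm hf hk hε hε1 hδ hδ1 hn => ?_⟩
  have hP := isProbabilityMeasure_densityMeasure hIm hf
  have hna : NullSingletonClass (densityMeasure I f) := by
    unfold densityMeasure; infer_instance
  set P := densityMeasure I f
  have hn0 : 0 < n := by
    have hL0 : 0 ≤ Real.log (1 / δ) := Real.log_nonneg (by rw [le_div_iff₀ hδ]; linarith)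
    have : (0 : ℝ) < n := lt_of_lt_of_le (by positivity) hn
    exact_mod_cast this
  obtain ⟨J, hJ1, hJ2⟩ := exists_nat_pow_near (x := 64 / ε) (y := (2 : ℝ))
    (by rw [le_div_iff₀ hε]; linarith) (by norm_num)
  rw [le_div_iff₀ hε] at hJ1
  rw [div_lt_iff₀ hε, pow_succ] at hJ2
  set bad : ℕ → Set (Fin n → ℝ) := fun j => {X | ∃ (s : ℕ → SignType) (T : Finset ℕ),
    T.card ≤ 4 * k ∧ (∀ c ∉ T, s c = 0) ∧ levelDeviation ε j <
      ∫ x, (s (cellIndex P k j x) : ℝ) ∂(empMeasure n X) - ∫ x, (s (cellIndex P k j x) : ℝ) ∂P}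
  have hbadle : ∀ j ∈ Finset.range (J + 1),
      (Measure.pi fun _ : Fin n => P).real (bad j) ≤ δ * (1 / 2) ^ (j + 1) := by
    intro j hj
    refine le_trans ?_ (level_failure_bound (j := j) hk hε hδ hδ1 hn)
    refine measure_exists_sign_deviation_le (monotone_cellIndex P k j).measurable hn0
      (cellIndex_le P k j) (measure_cellIndex_preimage_le hk j)
      (by unfold chernoffRate; positivity)
      (chernoffRate_le_one hε (Nat.lt_succ_iff.1 (Finset.mem_range.1 hj)) (by linarith))
      (by positivity) ?_ _
    rw [← one_div_pow]; exact pow_le_one₀ (by norm_num) (by norm_num)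
  set S : Set (Fin n → ℝ) := {X | akDist k I f (empMeasure n X) ≤ ε}
  have hcompl : Sᶜ ⊆ ⋃ j ∈ Finset.range (J + 1), bad j := by
    intro X hX
    by_contra hgood
    refine hX (Real.sSup_le ?_ hε.le)
    rintro _ ⟨A, hA, hd, rfl⟩
    have hν := isProbabilityMeasure_empMeasure hn0 X
    simp only [mem_iUnion, not_exists] at hgood
    have key := sum_abs_measure_sub_le (P := P) (ν := empMeasure n X) (J := J)
      (monotone_cellIndex P k) (cellIndex_eq_div_two P k) hk
      (fun x => by simpa using cellIndex_le P k 0 x) (measure_cellIndex_preimage_le hk J)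
      (t := levelDeviation ε) (fun j hj s T hT hs => by
        by_contra hcon
        exact hgood j (Finset.mem_range.2 (Nat.lt_succ_of_le hj))
          ⟨s, T, hT, hs, not_le.1 hcon⟩) (fun i => (hA i).2) hd
    have heq : ∑ i, |(empMeasure n X (A i)).toReal - ∫ x in A i, f x| =
        ∑ i, |(empMeasure n X).real (A i) - P.real (A i)| :=
      Finset.sum_congr rfl fun i _ => by
        rw [densityMeasure_real_eq hf (hA i).2.measurableSet (hA i).1, Measure.real]
    rw [heq]
    refine key.trans ?_
    have h1 := sum_levelDeviation_le hε (J + 1)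
    have h2 : levelDeviation ε J ≤ ∑ j ∈ Finset.range (J + 1), levelDeviation ε j :=
      Finset.single_le_sum (fun j _ => levelDeviation_nonneg hε j) (Finset.self_mem_range_succ J)
    have h3 : (4 * k * (1 / (k * 2 ^ J)) : ℝ) ≤ 1 / 8 * ε := by
      have : (4 * k * (1 / (k * 2 ^ J)) : ℝ) = 4 / 2 ^ J := by
        have : (k : ℝ) ≠ 0 := by positivity
        field_simp
      rw [this, div_le_iff₀ (by positivity)]
      linarith
    linarith
  have hfail : (Measure.pi fun _ : Fin n => P) Sᶜ ≤ ENNReal.ofReal δ := by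
    rw [← ofReal_measureReal]
    refine ENNReal.ofReal_le_ofReal ?_
    refine (measureReal_mono hcompl (measure_ne_top _ _)).trans
      ((measureReal_biUnion_finset_le _ _).trans ((Finset.sum_le_sum hbadle).trans ?_))
    rw [← Finset.mul_sum]
    exact mul_le_of_le_one_right hδ.le (sum_half_pow_succ_le _)
  rw [ENNReal.ofReal_sub _ hδ.le, ENNReal.ofReal_one, tsub_le_iff_right]
  calc (1 : ENNReal) = (Measure.pi fun _ : Fin n => P) (S ∪ Sᶜ) := by
        rw [union_compl_self, measure_univ]
    _ ≤ (Measure.pi fun _ : Fin n => P) S + (Measure.pi fun _ : Fin n => P) Sᶜ :=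
        measure_union_le _ _
    _ ≤ _ := by gcongr
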